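/- Security of the O-OT gate when Alice's inputs pass through a measuring classical channel: add two ancilla qubits M1, M2 initialized to |0⟩ (the environment of the classical channel) and, before applying the O-OT gate, apply CNOTs with controls A1, A2 and targets M1, M2 respectively. For c ∈ {0,1}, let out'_c be the resulting global state on the eight qubits (A1,A2,T1,T2,T3,B,M1,M2) when the input is (1/2)(|00⟩+|01⟩+|10⟩+|11⟩)_{A1A2} ⊗ |Φ+⟩_{T1T2} ⊗ |0⟩_{T3} ⊗ |c⟩_B ⊗ |00⟩_{M1M2}. Then for both c = 0 and c = 1 the reduced density operator on Alice's registers is maximally mixed: Tr_{(T2,T3,B,M1,M2)}|out'_c⟩⟨out'_c| = (1/8)·I on the three-qubit space of (A1,A2,T1). In particular the two reduced states are equal, so Alice learns nothing about Bob's choice c. -/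

import Mathlib

open Matrix Kronecker

/-- Index type of the six-qubit state space, listing the registers
`(A1, A2, T1, T2, T3, B)`: `A1, A2` are Alice's inputs, `T1, T2, T3` the
trusted party's qubits J and `B` Bob's input. -/
abbrev Idx6 : Type := Fin 2 × Fin 2 × Fin 2 × Fin 2 × Fin 2 × Fin 2

/-- The computational basis vector `|a1 a2 t1 t2 t3 b⟩`. -/
def ket6 (a1 a2 t1 t2 t3 b : Fin 2) : Idx6 → ℂ :=
  fun x => if x = (a1, a2, t1, t2, t3, b) then 1 else 0

/-- The Pauli matrix `σ_x`. -/
def sigmaX : Matrix (Fin 2) (Fin 2) ℂ := !![0, 1; 1, 0]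

/-- The Pauli matrix `σ_z`. -/
def sigmaZ : Matrix (Fin 2) (Fin 2) ℂ := !![1, 0; 0, -1]

/-- The real matrix `iσ_y = [[0,1],[−1,0]]` (equal to `σ_y` up to a global phase). -/
def iSigmaY : Matrix (Fin 2) (Fin 2) ℂ := !![0, 1; -1, 0]

/-- The rotations `R_{b0 b1}`: `R_00 = I`, `R_01 = σ_z`, `R_10 = σ_x`, `R_11 = iσ_y`. -/
def Rot (b0 b1 : Fin 2) : Matrix (Fin 2) (Fin 2) ℂ :=
  if b0 = 0 then (if b1 = 0 then 1 else sigmaZ)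
  else (if b1 = 0 then sigmaX else iSigmaY)

/-- The single-qubit π/2 rotation about the y-axis,
`R = exp(−i(π/4)σ_y) = (1/√2)[[1,−1],[1,1]]`. -/
noncomputable def Ry : Matrix (Fin 2) (Fin 2) ℂ :=
  (1 / (Real.sqrt 2 : ℂ)) • !![1, -1; 1, 1]

/-- The bilateral π/2 rotation `B_y = R ⊗ R`. -/
noncomputable def By : Matrix (Fin 2 × Fin 2) (Fin 2 × Fin 2) ℂ := Ry ⊗ₖ Ry

/-- Gate (i) of the O-OT gate: the controlled rotation applying `R_{b0 b1}` to
`T1` when `(A1, A2)` hold the basis state `|b0 b1⟩`. -/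
def gate1 : Matrix Idx6 Idx6 ℂ :=
  fun x y =>
    (if x.1 = y.1 then 1 else 0) * (if x.2.1 = y.2.1 then 1 else 0) *
      Rot y.1 y.2.1 x.2.2.1 y.2.2.1 *
      (if x.2.2.2 = y.2.2.2 then 1 else 0)

/-- Gate (ii) of the O-OT gate: the controlled bilateral rotation applying
`B_y` to `(T1, T2)` when `B` holds `|1⟩`. -/
noncomputable def gate2 : Matrix Idx6 Idx6 ℂ :=
  fun x y =>
    (if x.1 = y.1 then 1 else 0) * (if x.2.1 = y.2.1 then 1 else 0) *
      (if x.2.2.2.2.1 = y.2.2.2.2.1 then 1 else 0) *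
      (if x.2.2.2.2.2 = y.2.2.2.2.2 then 1 else 0) *
      (if y.2.2.2.2.2 = 1 then By (x.2.2.1, x.2.2.2.1) (y.2.2.1, y.2.2.2.1)
       else (if x.2.2.1 = y.2.2.1 then 1 else 0) * (if x.2.2.2.1 = y.2.2.2.1 then 1 else 0))

/-- Gate (iii) of the O-OT gate: CNOT with control `T1` and target `T3`. -/
def gate3 : Matrix Idx6 Idx6 ℂ :=
  fun x y =>
    (if x.1 = y.1 then 1 else 0) * (if x.2.1 = y.2.1 then 1 else 0) *
      (if x.2.2.1 = y.2.2.1 then 1 else 0) * (if x.2.2.2.1 = y.2.2.2.1 then 1 else 0) *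
      (if x.2.2.2.2.1 = y.2.2.1 + y.2.2.2.2.1 then 1 else 0) *
      (if x.2.2.2.2.2 = y.2.2.2.2.2 then 1 else 0)

/-- The O-OT gate `G`: first the controlled rotation, then the controlled
bilateral rotation, then the CNOT. -/
noncomputable def ootGate : Matrix Idx6 Idx6 ℂ := gate3 * gate2 * gate1

/-- The input state `(1/2)(|00⟩+|01⟩+|10⟩+|11⟩)_{A1A2} ⊗ |Φ+⟩_{T1T2} ⊗ |0⟩_{T3} ⊗ |c⟩_B`,
written out as `(1/(2√2)) Σ_{a1 a2} (|a1 a2 0 0 0 c⟩ + |a1 a2 1 1 0 c⟩)`. -/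
noncomputable def inState (c : Fin 2) : Idx6 → ℂ :=
  (1 / (2 * (Real.sqrt 2 : ℂ))) •
    (ket6 0 0 0 0 0 c + ket6 0 1 0 0 0 c + ket6 1 0 0 0 0 c + ket6 1 1 0 0 0 c +
     ket6 0 0 1 1 0 c + ket6 0 1 1 1 0 c + ket6 1 0 1 1 0 c + ket6 1 1 1 1 0 c)

/-- Index type of the eight-qubit state space, listing the registers
`(A1, A2, T1, T2, T3, B, M1, M2)`, where `M1, M2` are the ancilla qubits of the
measuring classical channel (its environment). -/
abbrev Idx8 : Type := Fin 2 × Fin 2 × Fin 2 × Fin 2 × Fin 2 × Fin 2 × Fin 2 × Fin 2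

/-- Projection onto the six protocol registers `(A1, A2, T1, T2, T3, B)`. -/
def first6 (x : Idx8) : Idx6 :=
  (x.1, x.2.1, x.2.2.1, x.2.2.2.1, x.2.2.2.2.1, x.2.2.2.2.2.1)

/-- Projection onto the environment registers `(M1, M2)`. -/
def lastM (x : Idx8) : Fin 2 × Fin 2 := x.2.2.2.2.2.2

/-- The O-OT gate acting on the six protocol registers, tensored with the
identity on the environment registers `(M1, M2)`. -/
noncomputable def ootGate8 : Matrix Idx8 Idx8 ℂ :=
  fun x y => ootGate (first6 x) (first6 y) * (if lastM x = lastM y then 1 else 0)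

/-- The measuring classical channel: CNOTs with controls `A1, A2` and targets
`M1, M2` respectively, acting as the identity on all other registers. -/
def measChannel : Matrix Idx8 Idx8 ℂ :=
  fun x y =>
    (if first6 x = first6 y then 1 else 0) *
      (if (lastM x).1 = y.1 + (lastM y).1 then 1 else 0) *
      (if (lastM x).2 = y.2.1 + (lastM y).2 then 1 else 0)

/-- The eight-qubit input state
`(1/2)(|00⟩+|01⟩+|10⟩+|11⟩)_{A1A2} ⊗ |Φ+⟩_{T1T2} ⊗ |0⟩_{T3} ⊗ |c⟩_B ⊗ |00⟩_{M1M2}`. -/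
noncomputable def inState8 (c : Fin 2) : Idx8 → ℂ :=
  fun x => inState c (first6 x) * (if lastM x = ((0 : Fin 2), (0 : Fin 2)) then 1 else 0)

/-- The resulting global state `out'_c` on the eight qubits: first the CNOTs of
the measuring classical channel, then the O-OT gate. -/
noncomputable def outState8 (c : Fin 2) : Idx8 → ℂ :=
  (ootGate8 * measChannel).mulVec (inState8 c)

/-- The rank-one projection `|ψ⟩⟨ψ|` onto the span of a vector `ψ`. -/
noncomputable def outerProj (ψ : Idx8 → ℂ) : Matrix Idx8 Idx8 ℂ :=
  fun x y => ψ x * star (ψ y)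

/-- The partial trace over the registers `(T2, T3, B, M1, M2)`, yielding an
operator on Alice's three-qubit space `(A1, A2, T1)`. -/
noncomputable def ptraceBobEnv (ρ : Matrix Idx8 Idx8 ℂ) :
    Matrix (Fin 2 × Fin 2 × Fin 2) (Fin 2 × Fin 2 × Fin 2) ℂ :=
  fun u u' => ∑ t2 : Fin 2, ∑ t3 : Fin 2, ∑ b : Fin 2, ∑ m1 : Fin 2, ∑ m2 : Fin 2,
    ρ (u.1, u.2.1, u.2.2, t2, t3, b, m1, m2) (u'.1, u'.2.1, u'.2.2, t2, t3, b, m1, m2)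

lemma fin_two_eq_add_iff (a b c : Fin 2) : a = b + c ↔ c = a + b := by
  decide +revert

lemma gate1_mulVec (v : Idx6 → ℂ) (a1 a2 t1 t2 t3 b : Fin 2) :
    gate1.mulVec v (a1, a2, t1, t2, t3, b) =
      ∑ s, Rot a1 a2 t1 s * v (a1, a2, s, t2, t3, b) := by
  simp [mulVec, dotProduct, gate1, Fintype.sum_prod_type]

lemma gate2_mulVec (v : Idx6 → ℂ) (a1 a2 t1 t2 t3 b : Fin 2) :
    gate2.mulVec v (a1, a2, t1, t2, t3, b) =
      if b = 1 then ∑ s1, ∑ s2, By (t1, t2) (s1, s2) * v (a1, a2, s1, s2, t3, b)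
      else v (a1, a2, t1, t2, t3, b) := by
  fin_cases b <;> simp [mulVec, dotProduct, gate2, Fintype.sum_prod_type]

lemma gate3_mulVec (v : Idx6 → ℂ) (a1 a2 t1 t2 t3 b : Fin 2) :
    gate3.mulVec v (a1, a2, t1, t2, t3, b) = v (a1, a2, t1, t2, t3 + t1, b) := by
  simp [mulVec, dotProduct, gate3, Fintype.sum_prod_type, fin_two_eq_add_iff t3]

lemma ootGate8_mulVec (v : Idx8 → ℂ) (a1 a2 t1 t2 t3 b m1 m2 : Fin 2) :
    ootGate8.mulVec v (a1, a2, t1, t2, t3, b, m1, m2) =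
      ootGate.mulVec (fun y => v (y.1, y.2.1, y.2.2.1, y.2.2.2.1, y.2.2.2.2.1, y.2.2.2.2.2, m1, m2))
        (a1, a2, t1, t2, t3, b) := by
  simp [mulVec, dotProduct, ootGate8, Fintype.sum_prod_type, first6, lastM, ite_and]

lemma measChannel_mulVec (v : Idx8 → ℂ) (a1 a2 t1 t2 t3 b m1 m2 : Fin 2) :
    measChannel.mulVec v (a1, a2, t1, t2, t3, b, m1, m2) =
      v (a1, a2, t1, t2, t3, b, m1 + a1, m2 + a2) := by
  simp [mulVec, dotProduct, measChannel, Fintype.sum_prod_type, first6, lastM, ite_and,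
    fin_two_eq_add_iff m1, fin_two_eq_add_iff m2]

lemma inState_apply (c a1 a2 t1 t2 t3 b : Fin 2) :
    inState c (a1, a2, t1, t2, t3, b) =
      if t1 = t2 ∧ t3 = 0 ∧ b = c then 1 / (2 * (Real.sqrt 2 : ℂ)) else 0 := by
  fin_cases a1 <;> fin_cases a2 <;> fin_cases t1 <;> fin_cases t2 <;> simp [inState, ket6]

/-- The matrix of amplitudes of `(T1, T2)` in the output state when Alice's inputs are `(a1, a2)`
and Bob's input is `c`, up to normalization. -/
noncomputable def ampMatrix (c a1 a2 : Fin 2) : Matrix (Fin 2) (Fin 2) ℂ :=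
  if c = 1 then Ry * Rot a1 a2 * Ryᵀ else Rot a1 a2

lemma outState8_apply (c a1 a2 t1 t2 t3 b m1 m2 : Fin 2) :
    outState8 c (a1, a2, t1, t2, t3, b, m1, m2) =
      if t3 = t1 ∧ b = c ∧ m1 = a1 ∧ m2 = a2 then
        1 / (2 * (Real.sqrt 2 : ℂ)) * ampMatrix c a1 a2 t1 t2 else 0 := by
  have key (m a : Fin 2) : m + a = 0 ↔ m = a := by decide +revert
  rw [outState8, ← mulVec_mulVec, ootGate8_mulVec, ootGate, ← mulVec_mulVec, ← mulVec_mulVec,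
    gate3_mulVec, gate2_mulVec]
  simp only [gate1_mulVec, measChannel_mulVec, inState8, first6, lastM, inState_apply,
    Prod.mk.injEq, key]
  by_cases h3 : t3 = t1 <;> by_cases hb : b = c <;> by_cases h1 : m1 = a1 <;>
    by_cases h2 : m2 = a2 <;> simp [h3, hb, h1, h2]
  split_ifs with hc <;>
    simp [ampMatrix, hc, By, Matrix.mul_apply, Fin.sum_univ_two] <;> ring

lemma Rot_mul_conjTranspose (a1 a2 : Fin 2) : Rot a1 a2 * (Rot a1 a2)ᴴ = 1 := by
  fin_cases a1 <;> fin_cases a2 <;> ext i j <;> fin_cases i <;> fin_cases j <;>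
    simp [Rot, sigmaX, sigmaZ, iSigmaY, Matrix.mul_apply, Fin.sum_univ_two]

lemma ofReal_sqrt_two_sq : (Real.sqrt 2 : ℂ) ^ 2 = 2 := by
  norm_cast
  simp

lemma Ry_mul_conjTranspose : Ry * Ryᴴ = 1 := by
  have h := ofReal_sqrt_two_sq
  have h0 : (Real.sqrt 2 : ℂ) ≠ 0 := by simp
  ext i j
  fin_cases i <;> fin_cases j <;>
    simp [Ry, Matrix.mul_apply, Fin.sum_univ_two] <;> field_simp <;> rw [h] <;> norm_num

lemma Ry_transpose_mul_conjTranspose : Ryᵀ * Ryᵀᴴ = 1 := by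
  have h : Ryᵀ = Ryᴴ := by
    ext i j
    fin_cases i <;> fin_cases j <;> simp [Ry]
  rw [h, conjTranspose_conjTranspose]
  exact mul_eq_one_comm.mp Ry_mul_conjTranspose

lemma ampMatrix_mul_conjTranspose (c a1 a2 : Fin 2) :
    ampMatrix c a1 a2 * (ampMatrix c a1 a2)ᴴ = 1 := by
  unfold ampMatrix
  split_ifs
  · rw [conjTranspose_mul, conjTranspose_mul]
    calc _ = Ry * (Rot a1 a2 * (Ryᵀ * Ryᵀᴴ) * (Rot a1 a2)ᴴ) * Ryᴴ := by
          simp only [Matrix.mul_assoc]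
      _ = 1 := by
          rw [Ry_transpose_mul_conjTranspose, Matrix.mul_one, Rot_mul_conjTranspose,
            Matrix.mul_one, Ry_mul_conjTranspose]
  · exact Rot_mul_conjTranspose a1 a2

/-- **Security of the O-OT gate when Alice's inputs pass through a measuring
classical channel:** for both of Bob's choices `c = 0, 1`, the reduced density
operator on Alice's registers `(A1, A2, T1)` is the maximally mixed state
`(1/8)·I`; in particular the two reduced states are equal, so Alice learns
nothing about Bob's choice `c`. -/
theorem ootGate_classical_channel_secure :
    ∀ c : Fin 2,
      ptraceBobEnv (outerProj (outState8 c)) =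
        (1 / 8 : ℂ) • (1 : Matrix (Fin 2 × Fin 2 × Fin 2) (Fin 2 × Fin 2 × Fin 2) ℂ) := by
  rintro c
  ext ⟨a1, a2, t⟩ ⟨a1', a2', t'⟩
  simp only [ptraceBobEnv, outerProj, outState8_apply, Matrix.smul_apply, one_apply, Prod.mk.injEq]
  by_cases h : a1 = a1' ∧ a2 = a2' ∧ t = t'
  · obtain ⟨rfl, rfl, rfl⟩ := h
    have hrow := congrFun (congrFun (ampMatrix_mul_conjTranspose c a1 a2) t) t
    simp only [mul_apply, conjTranspose_apply, one_apply_eq] at hrow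
    simp only [ite_and, apply_ite star, star_zero, mul_ite, ite_mul, mul_zero, zero_mul,
      Finset.sum_ite_eq', Finset.mem_univ, if_true, Finset.sum_ite_irrel, Finset.sum_const_zero]
    have hnorm : 1 / (2 * (Real.sqrt 2 : ℂ)) * star (1 / (2 * (Real.sqrt 2 : ℂ))) = 1 / 8 := by
      have h0 : (Real.sqrt 2 : ℂ) ≠ 0 := by simp
      simp only [Complex.star_def, map_div₀, map_mul, map_one, map_ofNat, Complex.conj_ofReal]
      field_simp
      rw [ofReal_sqrt_two_sq]
      norm_num
    rw [← hnorm, ← hrow, smul_eq_mul, Finset.mul_sum]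
    refine Finset.sum_congr rfl fun x _ => ?_
    rw [star_mul']
    ring
  · rw [if_neg h, smul_zero]
    refine Finset.sum_eq_zero fun t2 _ => Finset.sum_eq_zero fun t3 _ =>
      Finset.sum_eq_zero fun b _ => Finset.sum_eq_zero fun m1 _ => Finset.sum_eq_zero fun m2 _ => ?_
    split_ifs with h1 h2
    · exact absurd ⟨h1.2.2.1.symm.trans h2.2.2.1, h1.2.2.2.symm.trans h2.2.2.2,
        h1.1.symm.trans h2.1⟩ h
    all_goals simp
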